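/- Let γ : F → G be a morphism of finitely generated free persistence modules over a poset, B a finite basis of F, and C a basis of ker γ (assumed free). For c ∈ C, write [c]^B ∈ k^{|B|} for the coordinate vector of c with respect to B and B.c = { b ∈ B : the b-coordinate of [c]^B is nonzero }. Then gr(c) = ⋁_{b ∈ B.c} gr(b), i.e., the grade of c equals the join of the grades of the basis elements appearing in its expansion. -/

import Mathlib

open scoped Classical

noncomputable section

/-- A persistence module indexed by a poset `X`, with coefficients in a field `k`:
a functor from `X` to `Vect_k`, given concretely. -/
structure PersMod (X : Type) [PartialOrder X] (k : Type) [Field k] where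
  V : X → Type
  [addCommGroup : ∀ a, AddCommGroup (V a)]
  [module : ∀ a, Module k (V a)]
  map : ∀ {a b : X}, a ≤ b → (V a →ₗ[k] V b)
  map_id : ∀ a : X, map (le_refl a) = LinearMap.id
  map_comp : ∀ {a b c : X} (hab : a ≤ b) (hbc : b ≤ c),
    (map hbc).comp (map hab) = map (hab.trans hbc)

attribute [instance] PersMod.addCommGroup PersMod.module

/-- The free persistence module `⊕_{i} Q^{g i}` on generators at grades `g i`:
at index `a` it is the space of `k`-vectors supported on `{i : g i ≤ a}`. -/
def FreeMod {X : Type} [PartialOrder X] (k : Type) [Field k] {m : ℕ} (g : Fin m → X) :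
    PersMod X k where
  V a := {i : Fin m // g i ≤ a} → k
  map {a b} hab :=
    { toFun := fun f i => if h : g i.1 ≤ a then f ⟨i.1, h⟩ else 0
      map_add' := by
        intro f f'; funext i; by_cases h : g i.1 ≤ a <;> simp [h]
      map_smul' := by
        intro c f; funext i; by_cases h : g i.1 ≤ a <;> simp [h] }
  map_id a := by
    apply LinearMap.ext; intro f; funext i
    simp only [LinearMap.coe_mk, AddHom.coe_mk, LinearMap.id_coe, id_eq]
    rw [dif_pos i.2]
  map_comp {a b c} hab hbc := by
    apply LinearMap.ext; intro f; funext i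
    simp only [LinearMap.comp_apply, LinearMap.coe_mk, AddHom.coe_mk]
    by_cases h : g i.1 ≤ a
    · rw [dif_pos (h.trans hab), dif_pos h]
    · rw [dif_neg h]
      by_cases hb : g i.1 ≤ b
      · rw [dif_pos hb, dif_neg h]
      · rw [dif_neg hb]

/-- A morphism of persistence modules: a natural transformation. -/
structure PersHom {X : Type} [PartialOrder X] {k : Type} [Field k]
    (M N : PersMod X k) where
  app : ∀ a : X, M.V a →ₗ[k] N.V a
  natural : ∀ {a b : X} (h : a ≤ b), (N.map h).comp (app a) = (app b).comp (M.map h)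

/-- A set `S` of graded elements generates `M` if every element of `M` is a linear
combination of images of elements of `S` under the internal maps. -/
def IsGenSet {X : Type} [PartialOrder X] {k : Type} [Field k]
    (M : PersMod X k) (S : Set (Σ a : X, M.V a)) : Prop :=
  ∀ (a : X) (v : M.V a),
    v ∈ Submodule.span k {w : M.V a | ∃ s ∈ S, ∃ h : s.1 ≤ a, w = M.map h s.2}

/-- A basis of a persistence module is a minimal generating set. -/
def IsPMBasis {X : Type} [PartialOrder X] {k : Type} [Field k]
    (M : PersMod X k) (B : Set (Σ a : X, M.V a)) : Prop :=
  IsGenSet M B ∧ ∀ B' ⊆ B, IsGenSet M B' → B' = B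

/-- A persistence module is free if it is isomorphic to a finite direct sum of modules
`Q^x` (equivalently, to some `FreeMod g`). -/
def IsFree {X : Type} [PartialOrder X] {k : Type} [Field k] (M : PersMod X k) : Prop :=
  ∃ (m : ℕ) (g : Fin m → X) (φ : PersHom (FreeMod k g) M),
    ∀ a : X, Function.Bijective (φ.app a)


/-- The kernel of a morphism of persistence modules, as a persistence module. -/
def KerMod {X : Type} [PartialOrder X] {k : Type} [Field k]
    {M N : PersMod X k} (γ : PersHom M N) : PersMod X k where
  V a := LinearMap.ker (γ.app a)
  map {a b} hab := (M.map hab).restrict (p := LinearMap.ker (γ.app a))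
    (q := LinearMap.ker (γ.app b)) (by
      intro v hv
      have hnat := LinearMap.congr_fun (γ.natural hab) v
      simp only [LinearMap.comp_apply] at hnat
      simp only [LinearMap.mem_ker] at hv ⊢
      rw [← hnat, hv, map_zero])
  map_id a := by
    apply LinearMap.ext; intro v; apply Subtype.ext
    simp only [LinearMap.restrict_apply, LinearMap.id_coe, id_eq]
    exact LinearMap.congr_fun (M.map_id a) v.1
  map_comp {a b c} hab hbc := by
    apply LinearMap.ext; intro v; apply Subtype.ext
    simp only [LinearMap.comp_apply, LinearMap.restrict_apply]
    exact LinearMap.congr_fun (M.map_comp hab hbc) v.1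

/-- Elements generated by `S` at grade `a` are generated by `S` at every later grade. -/
lemma PersMod.map_mem_span {X : Type} [PartialOrder X] {k : Type} [Field k]
    (M : PersMod X k) (S : Set (Σ a : X, M.V a)) {a b : X} (hab : a ≤ b) {v : M.V a}
    (hv : v ∈ Submodule.span k {w : M.V a | ∃ s ∈ S, ∃ h : s.1 ≤ a, w = M.map h s.2}) :
    M.map hab v ∈
      Submodule.span k {w : M.V b | ∃ s ∈ S, ∃ h : s.1 ≤ b, w = M.map h s.2} := by
  refine Submodule.span_induction (p := fun v _ => M.map hab v ∈ Submodule.span k _)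
    ?_ ?_ ?_ ?_ hv
  · rintro _ ⟨s, hs, h, rfl⟩
    exact Submodule.subset_span
      ⟨s, hs, h.trans hab, LinearMap.congr_fun (M.map_comp h hab) s.2⟩
  · simp
  · intro x y _ _ hx hy
    rw [map_add]
    exact Submodule.add_mem _ hx hy
  · intro r x _ hx
    rw [map_smul]
    exact Submodule.smul_mem _ r hx

/-- A basis element is not the image of an element of strictly smaller grade. -/
lemma IsPMBasis.map_ne {X : Type} [PartialOrder X] {k : Type} [Field k]
    {M : PersMod X k} {C : Set (Σ a : X, M.V a)} (hC : IsPMBasis M C)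
    {c : Σ a : X, M.V a} (hc : c ∈ C) {d : X} (hd : d < c.1) (v : M.V d) :
    M.map hd.le v ≠ c.2 := by
  intro hv
  have hc_span : c.2 ∈ Submodule.span k
      {w : M.V c.1 | ∃ s ∈ C \ {c}, ∃ h : s.1 ≤ c.1, w = M.map h s.2} := by
    rw [← hv]
    refine M.map_mem_span _ hd.le (Submodule.span_mono ?_ (hC.1 d v))
    rintro _ ⟨s, hs, h, rfl⟩
    exact ⟨s, ⟨hs, fun hsc => hd.not_ge (Set.mem_singleton_iff.1 hsc ▸ h)⟩, h, rfl⟩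
  have hgen : IsGenSet M (C \ {c}) := by
    intro a w
    refine Submodule.span_le.2 ?_ (hC.1 a w)
    rintro _ ⟨s, hs, h, rfl⟩
    by_cases hsc : s = c
    · subst hsc
      exact M.map_mem_span _ h hc_span
    · exact Submodule.subset_span ⟨s, ⟨hs, hsc⟩, h, rfl⟩
  rw [← hC.2 _ Set.sdiff_subset hgen] at hc
  exact hc.2 rfl

/-- The internal maps of a free module are injective. -/
lemma FreeMod.map_injective {X : Type} [PartialOrder X] {k : Type} [Field k] {m : ℕ}
    (g : Fin m → X) {a b : X} (hab : a ≤ b) :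
    Function.Injective ((FreeMod k g).map hab) := by
  intro f f' hff
  funext i
  have hi : (if h : g i.1 ≤ a then f ⟨i.1, h⟩ else 0) =
      if h : g i.1 ≤ a then f' ⟨i.1, h⟩ else 0 := congrFun hff ⟨i.1, i.2.trans hab⟩
  rwa [dif_pos i.2, dif_pos i.2] at hi

/-- A vector whose support has grades at most `d` comes from grade `d`. -/
lemma FreeMod.exists_map_eq {X : Type} [PartialOrder X] {k : Type} [Field k] {m : ℕ}
    (g : Fin m → X) {d a : X} (hda : d ≤ a) (f : {i : Fin m // g i ≤ a} → k)
    (hf : ∀ i, f i ≠ 0 → g i.1 ≤ d) :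
    ∃ v, (FreeMod k g).map hda v = f := by
  refine ⟨fun i => f ⟨i.1, i.2.trans hda⟩, ?_⟩
  funext i
  change (if h : g i.1 ≤ d then f ⟨i.1, h.trans hda⟩ else 0) = f i
  split_ifs with h
  · rfl
  · by_contra h0
    exact h (hf i (Ne.symm h0))

/-- If the internal maps of the target are injective, a kernel element that comes from an
earlier grade in the source does so in the kernel. -/
lemma KerMod.exists_map_eq {X : Type} [PartialOrder X] {k : Type} [Field k]
    {M N : PersMod X k} (γ : PersHom M N) {d a : X} (hda : d ≤ a)
    (hN : Function.Injective (N.map hda)) (w : (KerMod γ).V a) (v : M.V d)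
    (hv : M.map hda v = w.1) :
    ∃ v', (KerMod γ).map hda v' = w := by
  have hker : γ.app d v = 0 := by
    apply hN
    have hnat := LinearMap.congr_fun (γ.natural hda) v
    simp only [LinearMap.comp_apply] at hnat
    rw [hnat, hv, map_zero]
    exact w.2
  exact ⟨⟨v, hker⟩, Subtype.ext hv⟩

/-- Let `γ : F → G` be a morphism of finitely generated free persistence modules over
`ℝ^n`, with `F = FreeMod g` carrying its standard basis `B` (indexed by `Fin m`, with
grades `g i`), and let `C` be a basis of `ker γ`. Then for each `c ∈ C`, the grade of `c`
is the join (least upper bound) of the grades `g i` of the standard basis elements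
appearing with nonzero coordinate in the expansion of `c`. -/
theorem ker_basis_grade_is_join {k : Type} [Field k] {n m m' : ℕ}
    (g : Fin m → (Fin n → ℝ)) (g' : Fin m' → (Fin n → ℝ))
    (γ : PersHom (FreeMod k g) (FreeMod k g'))
    (C : Set (Σ a : Fin n → ℝ, (KerMod γ).V a)) (hC : IsPMBasis (KerMod γ) C)
    (c : Σ a : Fin n → ℝ, (KerMod γ).V a) (hc : c ∈ C) :
    IsLUB {x : Fin n → ℝ | ∃ (i : Fin m) (h : g i ≤ c.1),
      (c.2.1 : {i : Fin m // g i ≤ c.1} → k) ⟨i, h⟩ ≠ 0 ∧ x = g i} c.1 := by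
  refine ⟨?_, fun u hu => ?_⟩
  · rintro _ ⟨i, h, -, rfl⟩
    exact h
  · by_contra hcu
    have hd : c.1 ⊓ u < c.1 := inf_lt_left.2 hcu
    obtain ⟨v, hv⟩ := FreeMod.exists_map_eq g hd.le c.2.1
      fun i hi => le_inf i.2 (hu ⟨i.1, i.2, hi, rfl⟩)
    obtain ⟨v', hv'⟩ := KerMod.exists_map_eq γ hd.le (FreeMod.map_injective g' hd.le) c.2 v hv
    exact hC.map_ne hc hd v' hv'

end
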